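/- Let τ ∈ ℂ with Im τ > 0, q := e^{2πiτ}. Let u, v ∈ ℂ∖(ℤ+ℤτ) and set x := e^{2πiu}, y := e^{2πiv}. Assume xy ∉ q^ℤ := {q^m : m ∈ ℤ}. Then Zwegers' μ-function satisfies μ(x,y) = i q^{−1/8} · e^{πi(u+v)} / ((q;q)_∞ θ(xy)) · { Σ_{n∈ℤ} x^{2n} y^{2n} q^{2n²} / ((1 − x q^n)(1 − y q^n)) − Σ_{n∈ℤ} x^{−2n} y^{−2n} q^{2n²} / ((1 − x^{−1} q^n)(1 − y^{−1} q^n)) }, both bilateral sums being absolutely convergent. -/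

import Mathlib

noncomputable section

/-- `e z = exp(2πiz)`. -/
def e (z : ℂ) : ℂ := Complex.exp (2 * (Real.pi : ℂ) * Complex.I * z)

/-- Infinite q-Pochhammer symbol `(a;q)_∞`. -/
def qpinf (a q : ℂ) : ℂ := ∏' j : ℕ, (1 - a * q ^ j)

/-- `θ(x) = (x;q)_∞ (q/x;q)_∞`. -/
def qtheta (q x : ℂ) : ℂ := qpinf x q * qpinf (q / x) q

/-- Jacobi theta `ϑ₁₁(v) = -i q^{1/8} e^{-πiv} (q;q)_∞ θ(e^{2πiv})`. -/
def theta11 (τ v : ℂ) : ℂ :=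
  -Complex.I * e (τ / 8) * e (-v / 2) * qpinf (e τ) (e τ) * qtheta (e τ) (e v)

/-- Zwegers' μ-function. -/
def zMu (τ u v : ℂ) : ℂ :=
  e (u / 2) / theta11 τ v *
    ∑' n : ℤ, (-1 : ℂ) ^ n * e ((n : ℂ) * v) * (e τ) ^ ((n * (n + 1)) / 2) /
      (1 - e u * (e τ) ^ n)

open Filter Topology

lemma e_add (a b : ℂ) : e (a + b) = e a * e b := by
  rw [e, e, e, ← Complex.exp_add, mul_add]

lemma e_zero : e 0 = 1 := by simp [e]

lemma e_ne_zero (a : ℂ) : e a ≠ 0 := Complex.exp_ne_zero _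

lemma e_neg (a : ℂ) : e (-a) = (e a)⁻¹ := by
  rw [e, e, ← Complex.exp_neg, mul_neg]

lemma e_sub (a b : ℂ) : e (a - b) = e a / e b := by
  rw [sub_eq_add_neg, e_add, e_neg, div_eq_mul_inv]

lemma e_intCast_mul (n : ℤ) (a : ℂ) : e (n * a) = e a ^ n := by
  rw [e, e, ← Complex.exp_int_mul]
  ring_nf

lemma e_natCast_mul (n : ℕ) (a : ℂ) : e (n * a) = e a ^ n := by
  simpa using e_intCast_mul n a

lemma e_one : e 1 = 1 := by
  rw [e, mul_one, Complex.exp_two_pi_mul_I]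

lemma e_intCast (n : ℤ) : e n = 1 := by
  simpa [e_one] using e_intCast_mul n 1

lemma e_half : e (1 / 2) = -1 := by
  rw [e, ← Complex.exp_pi_mul_I]
  ring_nf

lemma e_add_one (a : ℂ) : e (a + 1) = e a := by rw [e_add, e_one, mul_one]

lemma e_eq_one_iff {a : ℂ} : e a = 1 ↔ ∃ n : ℤ, a = n := by
  rw [e, Complex.exp_eq_one_iff]
  refine exists_congr fun n => ?_
  rw [mul_comm (n : ℂ)]
  exact mul_right_inj' Complex.two_pi_I_ne_zero

lemma norm_e (a : ℂ) : ‖e a‖ = Real.exp (-(2 * Real.pi * a.im)) := by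
  rw [e, Complex.norm_exp]
  simp

lemma norm_e_lt_one {τ : ℂ} (hτ : 0 < τ.im) : ‖e τ‖ < 1 := by
  rw [norm_e, Real.exp_lt_one_iff]
  have := mul_pos Real.two_pi_pos hτ
  linarith

@[fun_prop]
lemma differentiable_e : Differentiable ℂ e := by
  unfold e
  fun_prop

lemma hasDerivAt_e_zero : HasDerivAt e (2 * (Real.pi : ℂ) * Complex.I) 0 := by
  have h := (hasDerivAt_const_mul (x := (0 : ℂ)) (2 * (Real.pi : ℂ) * Complex.I)).cexp
  rw [mul_zero, Complex.exp_zero, one_mul] at h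
  exact h

section Pochhammer

variable {q : ℂ}

lemma summable_norm_mul_pow (hq : ‖q‖ < 1) (a : ℂ) : Summable fun j : ℕ => ‖-(a * q ^ j)‖ := by
  simpa using (summable_geometric_of_lt_one (norm_nonneg q) hq).mul_left ‖a‖

lemma multipliable_one_sub_mul_pow (hq : ‖q‖ < 1) (a : ℂ) :
    Multipliable fun j : ℕ => 1 - a * q ^ j := by
  simpa only [← sub_eq_add_neg] using
    multipliable_one_add_of_summable (summable_norm_mul_pow hq a)

lemma qpinf_eq_mul (hq : ‖q‖ < 1) (a : ℂ) : qpinf a q = (1 - a) * qpinf (q * a) q := by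
  have hshift (j : ℕ) : 1 - q * a * q ^ j = 1 - a * q ^ (j + 1) := by ring
  have h := multipliable_one_sub_mul_pow hq (q * a)
  simp only [hshift] at h
  have h' := tprod_eq_zero_mul' (f := fun j : ℕ => 1 - a * q ^ j) h
  simp only [pow_zero, mul_one] at h'
  simpa only [qpinf, hshift] using h'

lemma qpinf_ne_zero (hq : ‖q‖ < 1) {a : ℂ} (ha : ∀ j : ℕ, a * q ^ j ≠ 1) : qpinf a q ≠ 0 := by
  have := tprod_one_add_ne_zero_of_summable (f := fun j : ℕ => -(a * q ^ j))
    (fun j => by rw [← sub_eq_add_neg]; exact sub_ne_zero.2 (ha j).symm)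
    (summable_norm_mul_pow hq a)
  simpa [qpinf, sub_eq_add_neg] using this

lemma differentiable_qpinf (hq : ‖q‖ < 1) : Differentiable ℂ fun a => qpinf a q := by
  intro a
  have hball : a ∈ Metric.ball (0 : ℂ) (‖a‖ + 1) := by simp
  have h := (Summable.hasProdLocallyUniformlyOn_nat_one_add (R := ℂ)
    (f := fun j b => -(b * q ^ j)) (K := Metric.ball (0 : ℂ) (‖a‖ + 1)) Metric.isOpen_ball
    ((summable_geometric_of_lt_one (norm_nonneg q) hq).mul_left (‖a‖ + 1))
    (.of_forall fun j b hb => by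
      rw [norm_neg, norm_mul, norm_pow]
      gcongr
      exact (mem_ball_zero_iff.1 hb).le) (fun _ => by fun_prop)).differentiableOn
    (.of_forall fun _ => by
      simpa [Finset.prod_fn] using DifferentiableOn.finsetProd (fun _ _ => by fun_prop))
    Metric.isOpen_ball
  simpa [qpinf, sub_eq_add_neg] using (h a hball).differentiableAt (Metric.isOpen_ball.mem_nhds hball)

end Pochhammer

/-- The theta function `u ↦ θ(e^{2πiu})`. -/
def addTheta (τ u : ℂ) : ℂ := qtheta (e τ) (e u)

/-- The quotient of `addTheta τ u` by `1 - e u`, extended to its removable singularities. -/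
def thetaQuot (τ u : ℂ) : ℂ := qpinf (e (τ + u)) (e τ) * qpinf (e (τ - u)) (e τ)

/-- The quotient of `addTheta τ u` by `1 - e (u + n * τ)`, extended to its removable
singularities. -/
def thetaQuotInt (τ : ℂ) (n : ℤ) (u : ℂ) : ℂ :=
  e (n / 2 + n * (n - 1) / 2 * τ + n * u) * thetaQuot τ (u + n * τ)

section Theta

variable {τ : ℂ}

lemma addTheta_eq_mul (hτ : 0 < τ.im) (u : ℂ) : addTheta τ u = (1 - e u) * thetaQuot τ u := by
  rw [addTheta, qtheta, qpinf_eq_mul (norm_e_lt_one hτ), thetaQuot, e_add, e_sub, mul_assoc]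

lemma differentiable_thetaQuot (hτ : 0 < τ.im) : Differentiable ℂ (thetaQuot τ) := by
  have h := differentiable_qpinf (norm_e_lt_one hτ)
  exact (h.comp (by fun_prop : Differentiable ℂ fun u => e (τ + u))).mul
    (h.comp (by fun_prop : Differentiable ℂ fun u => e (τ - u)))

lemma differentiable_thetaQuotInt (hτ : 0 < τ.im) (n : ℤ) :
    Differentiable ℂ (thetaQuotInt τ n) := by
  have h := differentiable_thetaQuot hτ
  unfold thetaQuotInt
  fun_prop

lemma differentiable_addTheta (hτ : 0 < τ.im) : Differentiable ℂ (addTheta τ) := by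
  have h := differentiable_thetaQuot hτ
  rw [funext (addTheta_eq_mul hτ)]
  fun_prop

lemma thetaQuot_add_one (u : ℂ) : thetaQuot τ (u + 1) = thetaQuot τ u := by
  rw [thetaQuot, thetaQuot, ← add_assoc, e_add_one, ← e_add_one (τ - (u + 1))]
  ring_nf

lemma addTheta_add_one (u : ℂ) : addTheta τ (u + 1) = addTheta τ u := by
  rw [addTheta, e_add_one, addTheta]

lemma addTheta_add_self (hτ : 0 < τ.im) (u : ℂ) :
    addTheta τ (u + τ) = -e (-u) * addTheta τ u := by
  have h := norm_e_lt_one hτ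
  have h1 := qpinf_eq_mul h (e u)
  have h2 := qpinf_eq_mul h (e (-u))
  have h3 : e τ / e (u + τ) = e (-u) := by rw [← e_sub]; ring_nf
  have h4 : e τ / e u = e τ * e (-u) := by rw [← e_sub, ← e_add]; ring_nf
  have h5 : e (-u) * e u = 1 := by rw [← e_add, neg_add_cancel, e_zero]
  rw [addTheta, addTheta, qtheta, qtheta, h1, h3, h4, h2, add_comm u, e_add]
  linear_combination (-qpinf (e τ * e u) (e τ) * qpinf (e τ * e (-u)) (e τ)) * h5

lemma addTheta_add_intCast_mul (hτ : 0 < τ.im) (n : ℤ) (u : ℂ) :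
    addTheta τ u = e (n / 2 + n * (n - 1) / 2 * τ + n * u) * addTheta τ (u + n * τ) := by
  have key (n : ℤ) : e ((n + 1 : ℤ) / 2 + (n + 1 : ℤ) * ((n + 1 : ℤ) - 1) / 2 * τ + (n + 1 : ℤ) * u)
      * addTheta τ (u + (n + 1 : ℤ) * τ) =
      e (n / 2 + n * (n - 1) / 2 * τ + n * u) * addTheta τ (u + n * τ) := by
    have h := addTheta_add_self hτ (u + n * τ)
    rw [show u + (n + 1 : ℤ) * τ = u + n * τ + τ by push_cast; ring, h,
      show ((n + 1 : ℤ) : ℂ) / 2 + (n + 1 : ℤ) * ((n + 1 : ℤ) - 1) / 2 * τ + (n + 1 : ℤ) * u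
        = (n / 2 + n * (n - 1) / 2 * τ + n * u) + (u + n * τ) + 1 / 2 by push_cast; ring,
      e_add, e_half, e_add, e_neg]
    have := e_ne_zero (u + n * τ)
    field_simp
  induction n with
  | zero => simp [e_zero]
  | succ n ih =>
    have := key n
    push_cast at this ih ⊢
    rw [this, ← ih]
  | pred n ih =>
    have := key (-n - 1)
    rw [sub_add_cancel] at this
    rw [← this, ← ih]

lemma one_sub_mul_thetaQuotInt (hτ : 0 < τ.im) (n : ℤ) (u : ℂ) :
    (1 - e (u + n * τ)) * thetaQuotInt τ n u = addTheta τ u := by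
  rw [addTheta_add_intCast_mul hτ n, addTheta_eq_mul hτ, thetaQuotInt]
  ring

lemma thetaQuotInt_add_one (n : ℤ) (u : ℂ) : thetaQuotInt τ n (u + 1) = thetaQuotInt τ n u := by
  rw [thetaQuotInt, thetaQuotInt, add_right_comm u, thetaQuot_add_one, mul_add, mul_one,
    ← add_assoc, e_add _ (n : ℂ), e_intCast, mul_one]

lemma thetaQuotInt_add_self (n : ℤ) (u : ℂ) :
    thetaQuotInt τ n (u + τ) = -e (-u) * thetaQuotInt τ (n + 1) u := by
  rw [thetaQuotInt, thetaQuotInt, ← mul_assoc, neg_mul, ← e_add, ← mul_neg_one, ← e_half, ← e_add]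
  congr 1
  · rw [← e_add_one]
    congr 1
    push_cast
    ring
  · push_cast
    ring_nf

lemma e_add_intCast_mul_ne_one {u : ℂ} (hu : ∀ m n : ℤ, u ≠ m + n * τ) (n : ℤ) :
    e (u + n * τ) ≠ 1 := by
  intro h
  obtain ⟨m, hm⟩ := e_eq_one_iff.1 h
  exact hu m (-n) (by rw [eq_sub_of_add_eq hm]; push_cast; ring)

lemma addTheta_ne_zero (hτ : 0 < τ.im) {u : ℂ} (hu : ∀ m n : ℤ, u ≠ m + n * τ) :
    addTheta τ u ≠ 0 := by
  refine mul_ne_zero (qpinf_ne_zero (norm_e_lt_one hτ) fun j h => ?_)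
    (qpinf_ne_zero (norm_e_lt_one hτ) fun j h => ?_)
  · refine e_add_intCast_mul_ne_one hu j ?_
    rw [e_add, Int.cast_natCast, e_natCast_mul, h]
  · refine e_add_intCast_mul_ne_one hu (-(j + 1 : ℤ)) ?_
    rw [← e_natCast_mul, ← e_sub, ← e_add] at h
    rw [← inv_inj, ← e_neg, inv_one, ← h]
    push_cast
    ring_nf

lemma thetaQuot_zero_ne_zero (hτ : 0 < τ.im) : thetaQuot τ 0 ≠ 0 := by
  have h : qpinf (e τ) (e τ) ≠ 0 := by
    refine qpinf_ne_zero (norm_e_lt_one hτ) fun j h => ?_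
    have h' := congrArg norm h
    rw [← pow_succ', norm_pow, norm_one] at h'
    exact (pow_lt_one₀ (norm_nonneg _) (norm_e_lt_one hτ) j.succ_ne_zero).ne h'
  simpa [thetaQuot] using h

lemma exists_norm_thetaQuotInt_le (hτ : 0 < τ.im) {K : Set ℂ} (hK : IsCompact K) :
    ∃ M, ∀ (n : ℤ), ∀ u ∈ K, ‖thetaQuotInt τ n u‖ ≤ M := by
  obtain ⟨B, hB⟩ := hK.exists_bound_of_continuousOn (f := Complex.im)
    Complex.continuous_im.continuousOn
  obtain ⟨C, hC⟩ := hK.exists_bound_of_continuousOn (differentiable_addTheta hτ).continuous.continuousOn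
  choose M hM using fun n => hK.exists_bound_of_continuousOn
    (differentiable_thetaQuotInt hτ n).continuous.continuousOn
  obtain ⟨N, hN⟩ := exists_nat_gt ((B + 1) / τ.im)
  rw [div_lt_iff₀ hτ] at hN
  have hexp : (2 : ℝ) ≤ Real.exp (2 * Real.pi) := by
    have := Real.add_one_le_exp (2 * Real.pi)
    have := Real.pi_gt_three
    linarith
  refine ⟨∑ n ∈ Finset.Icc (-N : ℤ) N, |M n| + 2 * |C|, fun n u hu => ?_⟩
  by_cases hn : n ∈ Finset.Icc (-N : ℤ) N
  · have := Finset.single_le_sum (f := fun k => |M k|) (fun _ _ => abs_nonneg _) hn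
    have := (hM n u hu).trans (le_abs_self _)
    have := abs_nonneg C
    linarith
  · have hu' := abs_le.1 (hB u hu)
    have hhalf : 1 / 2 ≤ ‖1 - e (u + n * τ)‖ := by
      have him : (u + n * τ).im = u.im + n * τ.im := by simp
      rw [Finset.mem_Icc, not_and_or, not_le, not_le] at hn
      rcases hn with hn | hn
      · have hn' : (n : ℝ) ≤ -N := by exact_mod_cast hn.le
        have : (n : ℝ) * τ.im ≤ -N * τ.im := by gcongr
        have h2 : 2 ≤ ‖e (u + n * τ)‖ := by
          rw [norm_e]
          refine hexp.trans (Real.exp_le_exp.2 ?_)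
          rw [him]
          nlinarith [Real.pi_pos]
        have := norm_sub_norm_le (e (u + n * τ)) 1
        rw [norm_sub_rev, norm_one] at this
        linarith
      · have hn' : (N : ℝ) ≤ n := by exact_mod_cast hn.le
        have : (N : ℝ) * τ.im ≤ n * τ.im := by gcongr
        have h2 : ‖e (u + n * τ)‖ ≤ 1 / 2 := by
          have : ‖e (u + n * τ)‖ ≤ Real.exp (-(2 * Real.pi)) := by
            rw [norm_e]
            refine Real.exp_le_exp.2 ?_
            rw [him]
            nlinarith [Real.pi_pos]
          refine this.trans ?_
          rw [Real.exp_neg, one_div]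
          gcongr
        have := norm_sub_norm_le 1 (e (u + n * τ))
        rw [norm_one] at this
        linarith
    have h := congrArg norm (one_sub_mul_thetaQuotInt hτ n u)
    rw [norm_mul] at h
    have hC' := (hC u hu).trans (le_abs_self _)
    have hs : 0 ≤ ∑ n ∈ Finset.Icc (-N : ℤ) N, |M n| := Finset.sum_nonneg fun _ _ => abs_nonneg _
    have := mul_le_mul_of_nonneg_right hhalf (norm_nonneg (thetaQuotInt τ n u))
    linarith

end Theta

section Liouville

variable {τ : ℂ}

lemma exists_forall_le_of_periodic (hτ : 0 < τ.im) {f : ℂ → ℝ} (hf : Continuous f)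
    (h1 : Function.Periodic f 1) (h2 : Function.Periodic f τ) : ∃ M, ∀ u, f u ≤ M := by
  have hK : IsCompact ((fun p : ℝ × ℝ => (p.1 : ℂ) + p.2 * τ) ''
      (Set.Icc 0 1 ×ˢ Set.Icc 0 1)) :=
    (isCompact_Icc.prod isCompact_Icc).image (by fun_prop)
  obtain ⟨M, hM⟩ := hK.bddAbove_image hf.continuousOn
  refine ⟨M, fun u => ?_⟩
  set b := u.im / τ.im with hb
  set a := u.re - b * τ.re with ha
  have hu : u = a + b * τ := by
    apply Complex.ext
    · simp [ha]
    · simp [hb, hτ.ne']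
  have hper : f u = f ((Int.fract a : ℝ) + (Int.fract b : ℝ) * τ) := by
    have := (h1.int_mul ⌊a⌋) ((Int.fract a : ℝ) + (Int.fract b : ℝ) * τ)
    rw [← this, ← (h2.int_mul ⌊b⌋) ((Int.fract a : ℝ) + (Int.fract b : ℝ) * τ + ⌊a⌋ * 1), hu]
    congr 1
    have ha' : (a : ℂ) = ⌊a⌋ + Int.fract a := by exact_mod_cast (Int.floor_add_fract a).symm
    have hb' : (b : ℂ) = ⌊b⌋ + Int.fract b := by exact_mod_cast (Int.floor_add_fract b).symm
    rw [ha', hb']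
    ring
  rw [hper]
  exact hM ⟨_, ⟨(Int.fract a, Int.fract b), ⟨⟨Int.fract_nonneg a, (Int.fract_lt_one a).le⟩,
    ⟨Int.fract_nonneg b, (Int.fract_lt_one b).le⟩⟩, rfl⟩, rfl⟩

lemma eq_of_periodic (hτ : 0 < τ.im) {f : ℂ → ℂ} (hf : Differentiable ℂ f)
    (h1 : Function.Periodic f 1) (h2 : Function.Periodic f τ) (u v : ℂ) : f u = f v := by
  obtain ⟨M, hM⟩ := exists_forall_le_of_periodic hτ hf.continuous.norm
    (h1.comp norm) (h2.comp norm)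
  refine hf.apply_eq_apply_of_bounded (isBounded_iff_forall_norm_le.2 ⟨M, ?_⟩) u v
  rintro _ ⟨w, rfl⟩
  exact hM w

/-- A theta function of negative degree vanishes. -/
lemma eq_zero_of_quasiperiodic (hτ : 0 < τ.im) {f : ℂ → ℂ} (hf : Differentiable ℂ f)
    (h1 : Function.Periodic f 1) {c : ℂ} (h2 : ∀ u, f (u + τ) = e (2 * u + c) * f u) (u : ℂ) :
    f u = 0 := by
  set T := τ.im with hT
  set C := 2 * Real.pi * c.im - 2 * Real.pi * T with hC
  have hT' : 0 < 2 * Real.pi / T := by have := Real.pi_pos; positivity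
  set w : ℂ → ℝ := fun u => Real.exp (2 * Real.pi / T * u.im ^ 2 + C / T * u.im) with hw
  have hw2 (u : ℂ) : w (u + τ) = Real.exp (2 * Real.pi * (2 * u + c).im) * w u := by
    simp only [hw, ← Real.exp_add]
    congr 1
    simp only [Complex.add_im, Complex.mul_im, Complex.re_ofNat, Complex.im_ofNat, ← hT, hC]
    field_simp
    ring
  obtain ⟨M, hM⟩ := exists_forall_le_of_periodic hτ (f := fun u => ‖f u‖ * w u)
    (by have := hf.continuous; fun_prop)
    (fun u => by simp [hw, h1 u])
    (fun u => by
      simp only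
      rw [h2, hw2, norm_mul, norm_e, Real.exp_neg]
      have := (Real.exp_pos (2 * Real.pi * (2 * u + c).im)).ne'
      field_simp)
  obtain ⟨B, hB⟩ : ∃ B, ∀ u : ℂ, B ≤ 2 * Real.pi / T * u.im ^ 2 + C / T * u.im := by
    refine ⟨-(C / T) ^ 2 / (4 * (2 * Real.pi / T)), fun u => ?_⟩
    rw [div_le_iff₀ (by positivity)]
    nlinarith [sq_nonneg (2 * (2 * Real.pi / T) * u.im + C / T)]
  have hb : Bornology.IsBounded (Set.range f) := by
    refine isBounded_iff_forall_norm_le.2 ⟨M / Real.exp B, ?_⟩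
    rintro _ ⟨u, rfl⟩
    rw [le_div_iff₀ (Real.exp_pos B)]
    exact (mul_le_mul_of_nonneg_left (Real.exp_le_exp.2 (hB u)) (norm_nonneg _)).trans (hM u)
  have hconst := fun u => hf.apply_eq_apply_of_bounded hb u 0
  by_contra hne
  have he (v : ℂ) : e (2 * v + c) = 1 := by
    have h := h2 v
    rw [hconst, hconst v, ← hconst u] at h
    exact (mul_eq_right₀ hne).1 h.symm
  have h3 := he (1 / 4)
  rw [e_add, show 2 * (1 / 4 : ℂ) = 1 / 2 by norm_num, e_half] at h3
  have h4 := he 0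
  rw [mul_zero, zero_add] at h4
  rw [h4] at h3
  norm_num at h3

end Liouville

/-- The theta series `∑ (-1)^k q^(k(k-1)/2) e(kv)`. -/
def thetaSeries (τ v : ℂ) : ℂ := jacobiTheta₂ (v + 1 / 2 - τ / 2) τ

section ThetaSeries

variable {τ : ℂ}

lemma jacobiTheta₂_add_self (z τ : ℂ) :
    jacobiTheta₂ (z + τ) τ = e (-z - τ / 2) * jacobiTheta₂ z τ := by
  rw [jacobiTheta₂_add_left', e]
  ring_nf

lemma thetaSeries_add_self (v : ℂ) :
    thetaSeries τ (v + τ) = -e (-v) * thetaSeries τ v := by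
  rw [thetaSeries, thetaSeries, show v + τ + 1 / 2 - τ / 2 = v + 1 / 2 - τ / 2 + τ by ring,
    jacobiTheta₂_add_self, ← neg_one_mul (e (-v)), ← e_half, ← e_add, ← e_add_one]
  ring_nf

lemma thetaSeries_add_one (v : ℂ) : thetaSeries τ (v + 1) = thetaSeries τ v := by
  rw [thetaSeries, thetaSeries, ← jacobiTheta₂_add_left (v + 1 / 2 - τ / 2)]
  ring_nf

lemma differentiable_thetaSeries (hτ : 0 < τ.im) : Differentiable ℂ (thetaSeries τ) := by
  intro v
  exact (differentiableAt_jacobiTheta₂_fst (v + 1 / 2 - τ / 2) hτ).comp v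
    (f := fun v => v + 1 / 2 - τ / 2) (by fun_prop)

lemma thetaSeries_zero : thetaSeries τ 0 = 0 := by
  have h : thetaSeries τ 0 = -thetaSeries τ 0 := by
    calc thetaSeries τ 0 = jacobiTheta₂ (-(0 + 1 / 2 - τ / 2)) τ := by
          rw [jacobiTheta₂_neg_left, thetaSeries]
      _ = jacobiTheta₂ (-(0 + 1 / 2 - τ / 2) + 1) τ := by rw [jacobiTheta₂_add_left]
      _ = thetaSeries τ (0 + τ) := by rw [thetaSeries]; ring_nf
      _ = -thetaSeries τ 0 := by rw [thetaSeries_add_self, neg_zero, e_zero, neg_one_mul]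
  exact self_eq_neg.1 h

lemma differentiable_dslope {f : ℂ → ℂ} (hf : Differentiable ℂ f) (c : ℂ) :
    Differentiable ℂ (dslope f c) := by
  rw [← differentiableOn_univ, Complex.differentiableOn_dslope univ_mem]
  exact hf.differentiableOn

lemma exists_thetaSeries_eq_mul (hτ : 0 < τ.im) :
    ∃ κ, ∀ u, (∀ m n : ℤ, u ≠ m + n * τ) → thetaSeries τ u = κ * addTheta τ u := by
  set d₁ := dslope (thetaSeries τ) 0
  set d₂ := dslope e 0
  have hd₁ : Differentiable ℂ d₁ := differentiable_dslope (differentiable_thetaSeries hτ) 0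
  have hd₂ : Differentiable ℂ d₂ := differentiable_dslope differentiable_e 0
  have hq := differentiable_thetaQuot hτ
  have hS (u : ℂ) : thetaSeries τ u = u * d₁ u := by
    simpa [thetaSeries_zero] using (sub_smul_dslope (thetaSeries τ) 0 u).symm
  have hΘ (u : ℂ) : addTheta τ u = u * -(d₂ u * thetaQuot τ u) := by
    have h : u * d₂ u = e u - 1 := by simpa [e_zero] using sub_smul_dslope e 0 u
    rw [addTheta_eq_mul hτ]
    linear_combination thetaQuot τ u * h
  have hne : d₂ 0 * thetaQuot τ 0 ≠ 0 := by
    refine mul_ne_zero ?_ (thetaQuot_zero_ne_zero hτ)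
    rw [show d₂ 0 = deriv e 0 from dslope_same e 0, hasDerivAt_e_zero.deriv]
    exact Complex.two_pi_I_ne_zero
  set h : ℂ → ℂ := fun u => if addTheta τ u = 0 then d₁ 0 / -(d₂ 0 * thetaQuot τ 0)
    else thetaSeries τ u / addTheta τ u with hh
  have h1 : Function.Periodic h 1 := fun u => by
    simp only [hh, addTheta_add_one, thetaSeries_add_one]
  have h2 : Function.Periodic h τ := fun u => by
    have : e (-u) ≠ 0 := e_ne_zero _
    simp only [hh, addTheta_add_self hτ, thetaSeries_add_self, neg_mul, neg_eq_zero, mul_eq_zero,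
      this, false_or, neg_div_neg_eq, mul_div_mul_left _ _ this]
  have h0 : DifferentiableAt ℂ h 0 := by
    have hev : ∀ᶠ u in 𝓝 0, h u = d₁ u / -(d₂ u * thetaQuot τ u) := by
      filter_upwards [(hd₂.continuous.mul hq.continuous).continuousAt.eventually_ne hne] with u hu
      by_cases hu0 : u = 0
      · simp [hh, hu0, hΘ 0]
      · have : addTheta τ u ≠ 0 := by
          rw [hΘ]
          exact mul_ne_zero hu0 (neg_ne_zero.2 hu)
        simp only [hh, if_neg this]
        rw [hS, hΘ, mul_div_mul_left _ _ hu0]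
    refine DifferentiableAt.congr_of_eventuallyEq ?_ hev
    exact (hd₁ 0).div ((hd₂ 0).mul (hq 0)).neg (neg_ne_zero.2 hne)
  have hd : Differentiable ℂ h := by
    intro u
    by_cases hu : addTheta τ u = 0
    · obtain ⟨m, n, hmn⟩ : ∃ m n : ℤ, u = m + n * τ := by
        by_contra! hcon
        exact addTheta_ne_zero hτ hcon hu
      have hsub : h = fun v => h (v - u) := by
        funext v
        rw [← h2.sub_int_mul_eq n, ← h1.sub_int_mul_eq m, hmn]
        ring_nf
      rw [hsub]
      refine DifferentiableAt.comp u (g := h) ?_ (by fun_prop)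
      simpa using h0
    · have hev : ∀ᶠ v in 𝓝 u, h v = thetaSeries τ v / addTheta τ v := by
        filter_upwards [(differentiable_addTheta hτ).continuous.continuousAt.eventually_ne hu]
          with v hv
        simp [hh, hv]
      exact ((differentiable_thetaSeries hτ u).div (differentiable_addTheta hτ u)
        hu).congr_of_eventuallyEq hev
  refine ⟨h 0, fun u hu => ?_⟩
  have hu' := addTheta_ne_zero hτ hu
  rw [eq_of_periodic hτ hd h1 h2 0 u]
  simp only [hh, if_neg hu']
  rw [div_mul_cancel₀ _ hu']

end ThetaSeries

section Appell

variable {τ : ℂ}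

lemma thetaSeries_mul_addTheta (hτ : 0 < τ.im) (v w : ℂ) :
    addTheta τ w * thetaSeries τ v = addTheta τ v * thetaSeries τ w := by
  obtain ⟨κ, hκ⟩ := exists_thetaSeries_eq_mul hτ
  have key (u : ℂ) : thetaSeries τ u = κ * addTheta τ u := by
    by_cases hu : ∀ m n : ℤ, u ≠ m + n * τ
    · exact hκ u hu
    push Not at hu
    obtain ⟨m, n, rfl⟩ := hu
    set P : ℂ → Prop := fun u => thetaSeries τ u = κ * addTheta τ u with hP
    have h1 : Function.Periodic P 1 := fun u => by
      simp only [hP, thetaSeries_add_one, addTheta_add_one]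
    have h2 : Function.Periodic P τ := fun u => by
      simp only [hP, thetaSeries_add_self, addTheta_add_self hτ, mul_left_comm κ,
        mul_right_inj' (neg_ne_zero.2 (e_ne_zero _))]
    have h0 : P 0 := by
      simp only [hP, thetaSeries_zero, addTheta_eq_mul hτ, e_zero]
      ring
    have h3 : P (0 + m * 1 + n * τ) = P 0 := by
      rw [h2.int_mul n, h1.int_mul m]
    rw [zero_add, mul_one] at h3
    exact h3.mpr h0
  rw [key, key]
  ring

lemma e_add_intCast (a : ℂ) (n : ℤ) : e (a + n) = e a := by rw [e_add, e_intCast, mul_one]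

lemma jacobiTheta₂_term_eq_e (n : ℤ) (ζ σ : ℂ) :
    jacobiTheta₂_term n ζ σ = e (n * ζ + n ^ 2 * σ / 2) := by
  rw [jacobiTheta₂_term, e]
  ring_nf

/-- The Appell sum `∑ e(nζ + n²σ/2) / (1 - e(u + nτ))`,
multiplied by `θ(e(u))`. -/
def appell (τ ζ σ u : ℂ) : ℂ := ∑' n : ℤ, jacobiTheta₂_term n ζ σ * thetaQuotInt τ n u

lemma summable_norm_jacobiTheta₂_term {σ : ℂ} (hσ : 0 < σ.im) (ζ : ℂ) :
    Summable fun n : ℤ => ‖jacobiTheta₂_term n ζ σ‖ :=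
  ((summable_jacobiTheta₂_term_iff ζ σ).2 hσ).norm

lemma summable_norm_mul_of_bounded {f g : ℤ → ℂ} (hf : Summable fun n => ‖f n‖) {M : ℝ}
    (hg : ∀ n, ‖g n‖ ≤ M) : Summable fun n => ‖f n * g n‖ := by
  refine (hf.mul_right M).of_nonneg_of_le (fun _ => norm_nonneg _) fun n => ?_
  rw [norm_mul]
  exact mul_le_mul_of_nonneg_left (hg n) (norm_nonneg _)

lemma exists_norm_thetaQuotInt_le_apply (hτ : 0 < τ.im) (u : ℂ) :
    ∃ M, ∀ n, ‖thetaQuotInt τ n u‖ ≤ M := by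
  obtain ⟨M, hM⟩ := exists_norm_thetaQuotInt_le hτ (isCompact_singleton (x := u))
  exact ⟨M, fun n => hM n u rfl⟩

lemma summable_appell (hτ : 0 < τ.im) {σ : ℂ} (hσ : 0 < σ.im) (ζ u : ℂ) :
    Summable fun n : ℤ => jacobiTheta₂_term n ζ σ * thetaQuotInt τ n u := by
  obtain ⟨M, hM⟩ := exists_norm_thetaQuotInt_le_apply hτ u
  exact (summable_norm_mul_of_bounded (summable_norm_jacobiTheta₂_term hσ ζ) hM).of_norm

lemma differentiable_appell (hτ : 0 < τ.im) {σ : ℂ} (hσ : 0 < σ.im) {ζ : ℂ → ℂ}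
    (hζ : Differentiable ℂ ζ) : Differentiable ℂ fun u => appell τ (ζ u) σ u := by
  intro u₀
  set K : Set ℂ := Metric.closedBall u₀ 1
  have hK : IsCompact K := isCompact_closedBall u₀ 1
  obtain ⟨M, hM⟩ := exists_norm_thetaQuotInt_le hτ hK
  obtain ⟨S, hS⟩ := hK.exists_bound_of_continuousOn
    (Complex.continuous_im.comp hζ.continuous).continuousOn
  have hsum := (summable_pow_mul_jacobiTheta₂_term_bound S hσ 0).mul_right M
  simp only [pow_zero, one_mul] at hsum
  have hd : DifferentiableOn ℂ (fun u => appell τ (ζ u) σ u) (Metric.ball u₀ 1) := by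
    refine Complex.differentiableOn_tsum_of_summable_norm hsum (fun n => ?_) Metric.isOpen_ball
      fun n u hu => ?_
    · have hn := differentiable_thetaQuotInt hτ n
      simp only [jacobiTheta₂_term_eq_e]
      have := differentiable_e
      fun_prop
    · have hu' := Metric.ball_subset_closedBall hu
      rw [norm_mul]
      exact mul_le_mul (norm_jacobiTheta₂_term_le hσ (hS u hu') le_rfl n) (hM n u hu')
        (norm_nonneg _) (Real.exp_pos _).le
  exact hd.differentiableAt (Metric.ball_mem_nhds u₀ one_pos)

lemma appell_add_one_left (ζ σ u : ℂ) : appell τ (ζ + 1) σ u = appell τ ζ σ u := by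
  refine tsum_congr fun n => ?_
  rw [jacobiTheta₂_term_eq_e, jacobiTheta₂_term_eq_e,
    show (n : ℂ) * (ζ + 1) + n ^ 2 * σ / 2 = n * ζ + n ^ 2 * σ / 2 + n by ring, e_add_intCast]

lemma appell_add_one_right (ζ σ u : ℂ) : appell τ ζ σ (u + 1) = appell τ ζ σ u :=
  tsum_congr fun n => by rw [thetaQuotInt_add_one]

lemma appell_add_self (ζ σ u : ℂ) :
    appell τ ζ σ (u + τ) = -e (-u - ζ + σ / 2) * appell τ (ζ - σ) σ u := by
  simp only [appell, thetaQuotInt_add_self]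
  rw [← tsum_mul_left, ← (Equiv.addRight (1 : ℤ)).tsum_eq
    fun n => -e (-u - ζ + σ / 2) * (jacobiTheta₂_term n (ζ - σ) σ * thetaQuotInt τ n u)]
  refine tsum_congr fun n => ?_
  have h : e (-u - ζ + σ / 2) * jacobiTheta₂_term (n + 1) (ζ - σ) σ =
      jacobiTheta₂_term n ζ σ * e (-u) := by
    rw [jacobiTheta₂_term_eq_e, jacobiTheta₂_term_eq_e, ← e_add, ← e_add]
    push_cast
    ring_nf
  rw [Equiv.coe_addRight]
  linear_combination thetaQuotInt τ (n + 1) u * h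

lemma appell_eq_add (hτ : 0 < τ.im) {σ : ℂ} (hσ : 0 < σ.im) (ζ u : ℂ) :
    appell τ ζ σ u = addTheta τ u * jacobiTheta₂ ζ σ + e u * appell τ (ζ + τ) σ u := by
  rw [appell, appell, jacobiTheta₂, ← tsum_mul_left, ← tsum_mul_left, ← Summable.tsum_add]
  · refine tsum_congr fun n => ?_
    have h : e u * jacobiTheta₂_term n (ζ + τ) σ =
        jacobiTheta₂_term n ζ σ * e (u + n * τ) := by
      rw [jacobiTheta₂_term_eq_e, jacobiTheta₂_term_eq_e, ← e_add, ← e_add]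
      ring_nf
    rw [← one_sub_mul_thetaQuotInt hτ n u]
    linear_combination -thetaQuotInt τ n u * h
  · exact ((summable_jacobiTheta₂_term_iff ζ σ).2 hσ).mul_left _
  · exact (summable_appell hτ hσ _ u).mul_left _

lemma appell_eq_add_four (hτ : 0 < τ.im) {σ : ℂ} (hσ : 0 < σ.im) (ζ u : ℂ) :
    appell τ ζ σ u = addTheta τ u * (jacobiTheta₂ ζ σ + e u * jacobiTheta₂ (ζ + τ) σ +
      e u ^ 2 * jacobiTheta₂ (ζ + 2 * τ) σ + e u ^ 3 * jacobiTheta₂ (ζ + 3 * τ) σ) +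
      e u ^ 4 * appell τ (ζ + 4 * τ) σ u := by
  rw [appell_eq_add hτ hσ ζ, appell_eq_add hτ hσ (ζ + τ), appell_eq_add hτ hσ (ζ + τ + τ),
    appell_eq_add hτ hσ (ζ + τ + τ + τ)]
  ring_nf

lemma hasSum_int_even_add_odd {f : ℤ → ℂ} {a b : ℂ} (he : HasSum (fun k => f (2 * k)) a)
    (ho : HasSum (fun k => f (2 * k + 1)) b) : HasSum f (a + b) := by
  have h2 := mul_right_injective₀ (two_ne_zero' ℤ)
  replace ho := ((add_left_injective 1).comp h2).hasSum_range_iff.2 ho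
  refine (h2.hasSum_range_iff.2 he).add_isCompl ?_ ho
  simpa [Function.comp_def] using Int.isCompl_even_odd

lemma thetaSeries_eq_sub (hτ : 0 < τ.im) (w : ℂ) :
    thetaSeries τ w =
      jacobiTheta₂ (2 * w - τ) (4 * τ) - e w * jacobiTheta₂ (2 * w + τ) (4 * τ) := by
  have h4 : 0 < (4 * τ).im := by simpa using hτ
  rw [thetaSeries, jacobiTheta₂, sub_eq_add_neg (jacobiTheta₂ _ _), ← neg_mul]
  refine (hasSum_int_even_add_odd ?_ ?_).tsum_eq
  · refine (hasSum_jacobiTheta₂_term (2 * w - τ) h4).congr_fun fun n => ?_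
    rw [jacobiTheta₂_term_eq_e, jacobiTheta₂_term_eq_e]
    refine Eq.trans ?_ (e_add_intCast _ n)
    push_cast
    ring_nf
  · refine ((hasSum_jacobiTheta₂_term (2 * w + τ) h4).mul_left (-e w)).congr_fun fun n => ?_
    rw [jacobiTheta₂_term_eq_e, jacobiTheta₂_term_eq_e, ← neg_one_mul (e w), ← e_half,
      ← e_add, ← e_add]
    refine Eq.trans ?_ (e_add_intCast _ n)
    push_cast
    ring_nf

end Appell

section Identity

variable {τ : ℂ}

lemma addTheta_sub_self (hτ : 0 < τ.im) (v : ℂ) :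
    addTheta τ (v - τ) = -e (v - τ) * addTheta τ v := by
  have h := addTheta_add_self hτ (v - τ)
  rw [sub_add_cancel, e_neg] at h
  rw [h]
  field_simp [e_ne_zero (v - τ)]

lemma thetaSeries_sub_self (v : ℂ) : thetaSeries τ (v - τ) = -e (v - τ) * thetaSeries τ v := by
  have h := thetaSeries_add_self (τ := τ) (v - τ)
  rw [sub_add_cancel, e_neg] at h
  rw [h]
  field_simp [e_ne_zero (v - τ)]

/-- The difference of the two sides of the identity, cleared of denominators, as a function of
`u` with `u + v = w` fixed. -/
def muDefect (τ w u : ℂ) : ℂ :=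
  addTheta τ w * appell τ (w - u + 1 / 2 + τ / 2) τ u -
    addTheta τ (w - u) * appell τ (2 * w) (4 * τ) u -
    addTheta τ u * appell τ (2 * w) (4 * τ) (w - u) +
    addTheta τ u * addTheta τ (w - u) * jacobiTheta₂ (2 * w) (4 * τ)

lemma differentiable_muDefect (hτ : 0 < τ.im) (w : ℂ) : Differentiable ℂ (muDefect τ w) := by
  have h4 : 0 < (4 * τ).im := by simpa using hτ
  have hs : Differentiable ℂ fun u => w - u := by fun_prop
  have hΘ := differentiable_addTheta hτ
  have hΘ' := hΘ.comp hs
  have h1 := differentiable_appell hτ hτ (ζ := fun u => w - u + 1 / 2 + τ / 2) (by fun_prop)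
  have h2 := differentiable_appell hτ h4 (differentiable_const (2 * w))
  have h3 := h2.comp hs
  exact (((h1.const_mul _).sub (hΘ'.mul h2)).sub (hΘ.mul h3)).add ((hΘ.mul hΘ').mul_const _)

lemma periodic_muDefect (w : ℂ) : Function.Periodic (muDefect τ w) 1 := by
  intro u
  have h1 (f : ℂ → ℂ) (hf : ∀ v, f (v + 1) = f v) : f (w - (u + 1)) = f (w - u) := by
    rw [← hf (w - (u + 1))]
    ring_nf
  simp only [muDefect, addTheta_add_one, appell_add_one_right, h1 _ addTheta_add_one,
    h1 _ (appell_add_one_right (2 * w) (4 * τ))]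
  rw [h1 (fun v => appell τ (v + 1 / 2 + τ / 2) τ u) fun v => by
    rw [← appell_add_one_left (v + 1 / 2 + τ / 2)]
    ring_nf]

lemma jacobiTheta₂_sub_self (z τ : ℂ) :
    jacobiTheta₂ (z - τ) τ = e (z - τ / 2) * jacobiTheta₂ z τ := by
  have h := jacobiTheta₂_add_self (z - τ) τ
  rw [sub_add_cancel] at h
  rw [h, ← mul_assoc, ← e_add, show z - τ / 2 + (-(z - τ) - τ / 2) = 0 by ring, e_zero, one_mul]

lemma muDefect_add_self (hτ : 0 < τ.im) (w u : ℂ) :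
    muDefect τ w (u + τ) = e (2 * u + (τ - w)) * muDefect τ w u := by
  have h4 : 0 < (4 * τ).im := by simpa using hτ
  obtain ⟨v, rfl⟩ : ∃ v, w = u + v := ⟨w - u, by ring⟩
  have hv : u + v - u = v := by ring
  have hv' : u + v - (u + τ) = v - τ := by ring
  simp only [muDefect, hv, hv']
  have a1 : appell τ (v - τ + 1 / 2 + τ / 2) τ (u + τ) = e (τ - (u + v)) *
      (addTheta τ u * thetaSeries τ (v - τ) + e u * (addTheta τ u * thetaSeries τ v +
        e u * appell τ (v + 1 / 2 + τ / 2) τ u)) := by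
    have hc : -e (-u - (v - τ + 1 / 2 + τ / 2) + τ / 2) = e (τ - (u + v)) := by
      rw [← neg_one_mul, ← e_half, ← e_add]
      ring_nf
    rw [appell_add_self, hc, appell_eq_add hτ hτ, appell_eq_add hτ hτ (_ + τ), thetaSeries,
      thetaSeries]
    ring_nf
  have a2 : appell τ (2 * (u + v)) (4 * τ) (u + τ) = -e (-u - 2 * (u + v) + 2 * τ) *
      (addTheta τ u * (jacobiTheta₂ (2 * (u + v) - 4 * τ) (4 * τ) +
        e u * jacobiTheta₂ (2 * (u + v) + τ - 4 * τ) (4 * τ) +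
        e u ^ 2 * jacobiTheta₂ (2 * (u + v) + 2 * τ - 4 * τ) (4 * τ) +
        e u ^ 3 * jacobiTheta₂ (2 * (u + v) + 3 * τ - 4 * τ) (4 * τ)) +
        e u ^ 4 * appell τ (2 * (u + v)) (4 * τ) u) := by
    rw [appell_add_self, appell_eq_add_four hτ h4]
    ring_nf
  have a3 : appell τ (2 * (u + v)) (4 * τ) (v - τ) =
      -e (v + τ + 2 * (u + v)) * appell τ (2 * (u + v) + 4 * τ) (4 * τ) v := by
    have h := appell_add_self (τ := τ) (2 * (u + v) + 4 * τ) (4 * τ) (v - τ)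
    rw [sub_add_cancel, add_sub_cancel_right] at h
    rw [h, ← mul_assoc, neg_mul_neg, ← e_add,
      show v + τ + 2 * (u + v) + (-(v - τ) - (2 * (u + v) + 4 * τ) + 4 * τ / 2) = 0 by ring,
      e_zero, one_mul]
  have a4 := appell_eq_add_four hτ h4 (2 * (u + v)) v
  have a5 := thetaSeries_mul_addTheta hτ v (u + v)
  have a6 := thetaSeries_eq_sub hτ (u + v)
  have a7 : 2 * (u + v) - τ = 2 * (u + v) + 3 * τ - 4 * τ := by ring
  rw [a7] at a6
  simp only [jacobiTheta₂_sub_self] at a2 a6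
  rw [a1, a2, a3, thetaSeries_sub_self, addTheta_sub_self hτ, addTheta_add_self hτ]
  have d2 (a : ℂ) : e (2 * a) = e a ^ 2 := mod_cast e_natCast_mul 2 a
  have d3 (a : ℂ) : e (3 * a) = e a ^ 3 := mod_cast e_natCast_mul 3 a
  have d4 (a : ℂ) : 4 * a / 2 = 2 * a := by ring
  simp only [d4, d2, d3, e_add, e_sub, e_neg] at a6 ⊢
  have hx := e_ne_zero u
  have hy := e_ne_zero v
  have hq := e_ne_zero τ
  generalize e u = x at *
  generalize e v = y at *
  generalize e τ = q at *
  generalize jacobiTheta₂ (2 * (u + v)) (4 * τ) = S0 at *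
  generalize jacobiTheta₂ (2 * (u + v) + τ) (4 * τ) = S1 at *
  generalize jacobiTheta₂ (2 * (u + v) + 2 * τ) (4 * τ) = S2 at *
  generalize jacobiTheta₂ (2 * (u + v) + 3 * τ) (4 * τ) = S3 at *
  generalize appell τ (2 * (u + v) + 4 * τ) (4 * τ) v = B4 at *
  generalize appell τ (2 * (u + v)) (4 * τ) v = B at *
  generalize appell τ (2 * (u + v)) (4 * τ) u = B' at *
  generalize addTheta τ (u + v) = W at *
  generalize addTheta τ u = U at *
  generalize addTheta τ v = V at *
  generalize thetaSeries τ (u + v) = Tw at *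
  generalize thetaSeries τ v = Tv at *
  generalize appell τ (v + 1 / 2 + τ / 2) τ u = A at *
  subst a4 a6
  field_simp at a5 ⊢
  linear_combination q * U * (x * q - y) * a5

lemma muDefect_eq_zero (hτ : 0 < τ.im) (w u : ℂ) : muDefect τ w u = 0 :=
  eq_zero_of_quasiperiodic hτ (differentiable_muDefect hτ w) (periodic_muDefect w)
    (muDefect_add_self hτ w) u

end Identity

section Main

variable {τ u v : ℂ}

lemma inv_one_sub_eq_div (hτ : 0 < τ.im) (hu : ∀ m n : ℤ, u ≠ m + n * τ) (n : ℤ) :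
    (1 - e u * e τ ^ n)⁻¹ = thetaQuotInt τ n u / addTheta τ u := by
  have h := one_sub_mul_thetaQuotInt hτ n u
  have hΘ := addTheta_ne_zero hτ hu
  rw [e_add, e_intCast_mul] at h
  have hne : 1 - e u * e τ ^ n ≠ 0 := fun h0 => hΘ (by rw [← h, h0, zero_mul])
  field_simp
  exact h.symm

lemma exists_norm_inv_one_sub_le (hτ : 0 < τ.im) (hu : ∀ m n : ℤ, u ≠ m + n * τ) :
    ∃ M, ∀ n : ℤ, ‖(1 - e u * e τ ^ n)⁻¹‖ ≤ M := by
  obtain ⟨M, hM⟩ := exists_norm_thetaQuotInt_le_apply hτ u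
  refine ⟨M / ‖addTheta τ u‖, fun n => ?_⟩
  rw [inv_one_sub_eq_div hτ hu, norm_div]
  gcongr
  exact hM n

lemma one_sub_mul_zpow_ne_zero (hu : ∀ m n : ℤ, u ≠ m + n * τ) (n : ℤ) :
    1 - e u * e τ ^ n ≠ 0 := by
  rw [← e_intCast_mul, ← e_add]
  exact sub_ne_zero.2 (e_add_intCast_mul_ne_one hu n).symm

lemma e_zpow_mul_zpow_mul_zpow (u v τ : ℂ) (n : ℤ) :
    e u ^ (2 * n) * e v ^ (2 * n) * e τ ^ (2 * n ^ 2) =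
      jacobiTheta₂_term n (2 * (u + v)) (4 * τ) := by
  rw [jacobiTheta₂_term_eq_e, ← e_intCast_mul, ← e_intCast_mul, ← e_intCast_mul, ← e_add, ← e_add]
  push_cast
  ring_nf

lemma sum_zMu_eq (hτ : 0 < τ.im) (hu : ∀ m n : ℤ, u ≠ m + n * τ) (v : ℂ) :
    addTheta τ u * ∑' n : ℤ, (-1 : ℂ) ^ n * e ((n : ℂ) * v) * (e τ) ^ ((n * (n + 1)) / 2) /
      (1 - e u * (e τ) ^ n) = appell τ (v + 1 / 2 + τ / 2) τ u := by
  rw [appell, ← tsum_mul_left]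
  refine tsum_congr fun n => ?_
  have hdiv : (((n * (n + 1) / 2 : ℤ)) : ℂ) = n * (n + 1) / 2 := by
    obtain ⟨k, hk⟩ := Int.even_mul_succ_self n
    have h2 : n * (n + 1) / 2 = k := by omega
    rw [h2, eq_div_iff two_ne_zero]
    exact_mod_cast (by omega : k * 2 = n * (n + 1))
  have h : (-1 : ℂ) ^ n * e ((n : ℂ) * v) * (e τ) ^ ((n * (n + 1)) / 2) =
      jacobiTheta₂_term n (v + 1 / 2 + τ / 2) τ := by
    rw [jacobiTheta₂_term_eq_e, ← e_half, ← e_intCast_mul, ← e_intCast_mul, ← e_add, ← e_add, hdiv]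
    ring_nf
  rw [h, div_eq_mul_inv, inv_one_sub_eq_div hτ hu]
  field_simp [addTheta_ne_zero hτ hu]

lemma summable_norm_first (hτ : 0 < τ.im) (hu : ∀ m n : ℤ, u ≠ m + n * τ)
    (hv : ∀ m n : ℤ, v ≠ m + n * τ) :
    Summable fun n : ℤ => ‖e u ^ (2 * n) * e v ^ (2 * n) * e τ ^ (2 * n ^ 2) /
      ((1 - e u * e τ ^ n) * (1 - e v * e τ ^ n))‖ := by
  have h4 : 0 < (4 * τ).im := by simpa using hτ
  obtain ⟨M, hM⟩ := exists_norm_inv_one_sub_le hτ hu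
  obtain ⟨N, hN⟩ := exists_norm_inv_one_sub_le hτ hv
  simp only [e_zpow_mul_zpow_mul_zpow, div_eq_mul_inv, mul_inv, ← mul_assoc]
  exact summable_norm_mul_of_bounded
    (summable_norm_mul_of_bounded (summable_norm_jacobiTheta₂_term h4 _) hM) hN

lemma neg_ne_lattice (hu : ∀ m n : ℤ, u ≠ m + n * τ) (m n : ℤ) : -u ≠ m + n * τ := fun h =>
  hu (-m) (-n) (by push_cast; linear_combination -h)

lemma summable_norm_second (hτ : 0 < τ.im) (hu : ∀ m n : ℤ, u ≠ m + n * τ)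
    (hv : ∀ m n : ℤ, v ≠ m + n * τ) :
    Summable fun n : ℤ => ‖e u ^ (-(2 * n)) * e v ^ (-(2 * n)) * e τ ^ (2 * n ^ 2) /
      ((1 - (e u)⁻¹ * e τ ^ n) * (1 - (e v)⁻¹ * e τ ^ n))‖ := by
  simpa only [e_neg, inv_zpow'] using
    summable_norm_first hτ (neg_ne_lattice hu) (neg_ne_lattice hv)

lemma second_term_neg (hu : ∀ m n : ℤ, u ≠ m + n * τ) (hv : ∀ m n : ℤ, v ≠ m + n * τ) (n : ℤ) :
    e u ^ (-(2 * -n)) * e v ^ (-(2 * -n)) * e τ ^ (2 * (-n) ^ 2) /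
      ((1 - (e u)⁻¹ * e τ ^ (-n)) * (1 - (e v)⁻¹ * e τ ^ (-n))) =
    jacobiTheta₂_term n (2 * (u + v)) (4 * τ) *
      (((1 - e u * e τ ^ n)⁻¹ - 1) * ((1 - e v * e τ ^ n)⁻¹ - 1)) := by
  have hinv {a : ℂ} (ha : ∀ m n : ℤ, a ≠ m + n * τ) :
      (1 - (e a)⁻¹ * e τ ^ (-n))⁻¹ = -((1 - e a * e τ ^ n)⁻¹ - 1) := by
    have h1 := one_sub_mul_zpow_ne_zero ha n
    have h2 : e a * e τ ^ n ≠ 0 := mul_ne_zero (e_ne_zero _) (zpow_ne_zero _ (e_ne_zero _))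
    rw [zpow_neg, ← mul_inv]
    generalize e a * e τ ^ n = X at h1 h2
    have h3 : X - 1 ≠ 0 := by rwa [← neg_ne_zero, neg_sub]
    have h4 : 1 - X⁻¹ = (X - 1) / X := by field_simp
    rw [h4, inv_div]
    field_simp
    ring
  rw [mul_neg, neg_neg, neg_sq, e_zpow_mul_zpow_mul_zpow, div_eq_mul_inv, mul_inv, hinv hu,
    hinv hv, neg_mul_neg]

lemma addTheta_mul_sum_sub_sum (hτ : 0 < τ.im) (hu : ∀ m n : ℤ, u ≠ m + n * τ)
    (hv : ∀ m n : ℤ, v ≠ m + n * τ) :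
    addTheta τ u * addTheta τ v *
      ((∑' n : ℤ, e u ^ (2 * n) * e v ^ (2 * n) * e τ ^ (2 * n ^ 2) /
          ((1 - e u * e τ ^ n) * (1 - e v * e τ ^ n))) -
        ∑' n : ℤ, e u ^ (-(2 * n)) * e v ^ (-(2 * n)) * e τ ^ (2 * n ^ 2) /
          ((1 - (e u)⁻¹ * e τ ^ n) * (1 - (e v)⁻¹ * e τ ^ n))) =
      addTheta τ v * appell τ (2 * (u + v)) (4 * τ) u +
        addTheta τ u * appell τ (2 * (u + v)) (4 * τ) v -
        addTheta τ u * addTheta τ v * jacobiTheta₂ (2 * (u + v)) (4 * τ) := by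
  have h4 : 0 < (4 * τ).im := by simpa using hτ
  have s1 := (summable_norm_first hτ hu hv).of_norm
  have s2 := (summable_norm_second hτ hu hv).of_norm
  have t1 := summable_appell hτ h4 (2 * (u + v)) u
  have t2 := summable_appell hτ h4 (2 * (u + v)) v
  have t3 := (summable_jacobiTheta₂_term_iff (2 * (u + v)) (4 * τ)).2 h4
  rw [← (Equiv.neg ℤ).summable_iff, Function.comp_def] at s2
  rw [← (Equiv.neg ℤ).tsum_eq fun n : ℤ => e u ^ (-(2 * n)) * e v ^ (-(2 * n)) *
    e τ ^ (2 * n ^ 2) / ((1 - (e u)⁻¹ * e τ ^ n) * (1 - (e v)⁻¹ * e τ ^ n)),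
    ← s1.tsum_sub s2, appell, appell, jacobiTheta₂, ← tsum_mul_left, ← tsum_mul_left,
    ← tsum_mul_left, ← tsum_mul_left, ← (t1.mul_left _).tsum_add (t2.mul_left _),
    ← ((t1.mul_left _).add (t2.mul_left _)).tsum_sub (t3.mul_left _)]
  refine tsum_congr fun n => ?_
  simp only [Equiv.neg_apply]
  rw [second_term_neg hu hv, e_zpow_mul_zpow_mul_zpow, div_eq_mul_inv, mul_inv,
    inv_one_sub_eq_div hτ hu, inv_one_sub_eq_div hτ hv]
  field_simp [addTheta_ne_zero hτ hu, addTheta_ne_zero hτ hv]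
  ring

lemma prefactor_mul_eq {a d E F G P V W : ℂ} (hE : E ≠ 0) (hF : F ≠ 0) (hP : P ≠ 0)
    (hV : V ≠ 0) (hW : W ≠ 0) (h : W * a = V * d) :
    G / (-Complex.I * E * F⁻¹ * P * V) * a = Complex.I * E⁻¹ * (G * F) / (P * W) * d := by
  have hI := Complex.I_ne_zero
  field_simp
  rw [Complex.I_sq]
  linear_combination -G * h

end Main

theorem stmt5 (τ u v : ℂ) (hτ : 0 < τ.im)
    (hu : ∀ m n : ℤ, u ≠ (m : ℂ) + (n : ℂ) * τ)
    (hv : ∀ m n : ℤ, v ≠ (m : ℂ) + (n : ℂ) * τ)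
    (q x y : ℂ) (hq : q = e τ) (hx : x = e u) (hy : y = e v)
    (hxy : ∀ m : ℤ, x * y ≠ q ^ m) :
    Summable (fun n : ℤ =>
      ‖x ^ (2 * n) * y ^ (2 * n) * q ^ (2 * n ^ 2) /
        ((1 - x * q ^ n) * (1 - y * q ^ n))‖) ∧
    Summable (fun n : ℤ =>
      ‖x ^ (-(2 * n)) * y ^ (-(2 * n)) * q ^ (2 * n ^ 2) /
        ((1 - x⁻¹ * q ^ n) * (1 - y⁻¹ * q ^ n))‖) ∧
    zMu τ u v =
      Complex.I * e (-τ / 8) * e ((u + v) / 2) / (qpinf q q * qtheta q (x * y)) *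
        ((∑' n : ℤ, x ^ (2 * n) * y ^ (2 * n) * q ^ (2 * n ^ 2) /
            ((1 - x * q ^ n) * (1 - y * q ^ n)))
         - ∑' n : ℤ, x ^ (-(2 * n)) * y ^ (-(2 * n)) * q ^ (2 * n ^ 2) /
            ((1 - x⁻¹ * q ^ n) * (1 - y⁻¹ * q ^ n))) := by
  subst hq hx hy
  refine ⟨summable_norm_first hτ hu hv, summable_norm_second hτ hu hv, ?_⟩
  have hw (m n : ℤ) : u + v ≠ m + n * τ := fun h => hxy n <| by
    rw [← e_add, h, e_add, e_intCast, one_mul, e_intCast_mul]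
  have hU := addTheta_ne_zero hτ hu
  have hV := addTheta_ne_zero hτ hv
  have hW := addTheta_ne_zero hτ hw
  have h1 := sum_zMu_eq hτ hu v
  have h2 := addTheta_mul_sum_sub_sum hτ hu hv
  have h3 := muDefect_eq_zero hτ (u + v) u
  rw [muDefect, add_sub_cancel_left, ← h1] at h3
  rw [zMu, theta11, ← e_add, ← addTheta, ← addTheta]
  have hP : qpinf (e τ) (e τ) ≠ 0 := qpinf_ne_zero (norm_e_lt_one hτ) fun j h => by
    have := norm_e_lt_one hτ
    rw [← pow_succ'] at h
    have h' := congrArg norm h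
    rw [norm_pow, norm_one] at h'
    exact (pow_lt_one₀ (norm_nonneg _) this j.succ_ne_zero).ne h'
  have he : e ((u + v) / 2) = e (u / 2) * e (v / 2) := by rw [← e_add, add_div]
  rw [he, neg_div, neg_div, e_neg, e_neg]
  exact prefactor_mul_eq (e_ne_zero _) (e_ne_zero _) hP hV hW
    (mul_left_cancel₀ hU (by linear_combination h3 - h2))
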